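/- For A-bounded operators T, S, the minimax equality holds: inf_{γ∈ℂ} sup_{‖x‖_A=1} ‖(T + γS)x‖_A² = sup_{‖x‖_A=1} inf_{γ∈ℂ} ‖(T + γS)x‖_A². -/

import Mathlib

noncomputable section

open Filter Topology

variable {H : Type*} [NormedAddCommGroup H] [InnerProductSpace ℂ H]

/-- The semi-inner product induced by `A`: `⟨x, y⟩_A = ⟨A x, y⟩`. -/
def innerA (A : H →L[ℂ] H) (x y : H) : ℂ := @inner ℂ _ _ (A x) y

/-- The seminorm induced by `A`: `‖x‖_A = √⟨A x, x⟩`. -/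
def normA (A : H →L[ℂ] H) (x : H) : ℝ := Real.sqrt (innerA A x x).re

/-- The operator seminorm induced by `A`. -/
def opNormA (A T : H →L[ℂ] H) : ℝ :=
  sSup {r : ℝ | ∃ x : H, normA A x = 1 ∧ r = normA A (T x)}

/-- `T` is `A`-bounded. -/
def ABounded (A T : H →L[ℂ] H) : Prop :=
  ∃ c > 0, ∀ x : H, normA A (T x) ≤ c * normA A x

theorem aux_cross (c d : ℂ) : ∃ u : ℂ, ‖u‖ = 1 ∧ (u * d + (starRingEnd ℂ) u * c).im = 0 := by
  by_cases h : d - (starRingEnd ℂ) c = 0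
  · refine ⟨1, by simp, ?_⟩
    have h1 : d = (starRingEnd ℂ) c := by linear_combination h
    simp [h1]
  · set w := d - (starRingEnd ℂ) c with hw
    refine ⟨(starRingEnd ℂ) w / ‖w‖, ?_, ?_⟩
    · have : ‖w‖ ≠ 0 := by simpa using h
      simp [this]
    · have hd : d = w + (starRingEnd ℂ) c := by rw [hw]; ring
      rw [hd]
      simp [Complex.div_re, Complex.div_im, Complex.normSq_apply]
      ring

/-- Toeplitz-Hausdorff. -/
theorem toeplitz_hausdorff {W K : Type*} [NormedAddCommGroup W] [InnerProductSpace ℂ W]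
    [NormedAddCommGroup K] [InnerProductSpace ℂ K] (P R : W →L[ℂ] K) (E : Submodule ℂ W) :
    Convex ℝ ((fun x => inner ℂ (P x) (R x)) '' {x : W | x ∈ E ∧ ‖x‖ = 1}) := by
  rw [convex_iff_segment_subset]
  rintro _ ⟨x, ⟨hxE, hx⟩, rfl⟩ _ ⟨y, ⟨hyE, hy⟩, rfl⟩
  by_cases hpq : inner ℂ (P x) (R x) = inner ℂ (P y) (R y)
  · simp only [hpq, segment_same, Set.singleton_subset_iff]
    exact ⟨y, ⟨hyE, hy⟩, rfl⟩
  set p : ℂ := inner ℂ (P x) (R x) with hp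
  set q : ℂ := inner ℂ (P y) (R y) with hq
  have hD : q - p ≠ 0 := fun h => hpq (by linear_combination -h)
  -- normalised form
  let f : W → W → ℂ := fun a b => (inner ℂ (P a) (R b) - p * inner ℂ a b) / (q - p)
  obtain ⟨u, hu, him⟩ := aux_cross (f y x) (f x y)
  have fxx : f x x = 0 := by simp [f, hx, ← hp]
  have fyy : f y y = 1 := by simp [f, hy, ← hq, hD]
  have huu : (starRingEnd ℂ) u * u = 1 := by
    rw [mul_comm, Complex.mul_conj, Complex.normSq_eq_norm_sq, hu]; simp
  let z : ℝ → W := fun t => ((1 - t : ℝ) : ℂ) • x + ((t : ℂ) * u) • y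
  have fz : ∀ t, f (z t) (z t) =
      ((1 - t) * t : ℝ) * (u * f x y + (starRingEnd ℂ) u * f y x) + (t ^ 2 : ℝ) := by
    intro t
    have : f (z t) (z t) = ((1 - t : ℝ) : ℂ) ^ 2 * f x x + ((t : ℂ) ^ 2 * ((starRingEnd ℂ) u * u)) * f y y
        + ((1 - t) * t : ℝ) * (u * f x y + (starRingEnd ℂ) u * f y x) := by
      simp only [f, z, map_add, map_smul, inner_add_left, inner_add_right, inner_smul_left,
        inner_smul_right, map_mul, Complex.conj_ofReal]
      push_cast
      ring
    rw [this, fxx, fyy, huu]; push_cast; ring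
  have fim : ∀ t, (f (z t) (z t)).im = 0 := by
    intro t
    rw [fz, Complex.add_im, Complex.im_ofReal_mul, him, Complex.ofReal_im]; simp
  have hz0 : ∀ t, z t ≠ 0 := by
    intro t h0
    have h1 : f (z t) (z t) = 0 := by simp [h0, f]
    have h2 : ((1 - t : ℝ) : ℂ) • x = -(((t : ℂ) * u) • y) := by
      rw [eq_neg_iff_add_eq_zero]; exact h0
    have e1 : f (((1 - t : ℝ) : ℂ) • x) (((1 - t : ℝ) : ℂ) • x) = 0 := by
      have : f (((1 - t : ℝ) : ℂ) • x) (((1 - t : ℝ) : ℂ) • x) = ((1 - t : ℝ) : ℂ)^2 * f x x := by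
        simp only [f, map_smul, inner_smul_left, inner_smul_right, Complex.conj_ofReal]; ring
      rw [this, fxx]; simp
    have e2 : f (-(((t : ℂ) * u) • y)) (-(((t : ℂ) * u) • y)) = (t : ℂ) ^ 2 := by
      have : f (-(((t : ℂ) * u) • y)) (-(((t : ℂ) * u) • y)) =
          (t : ℂ) ^ 2 * ((starRingEnd ℂ) u * u) * f y y := by
        simp only [f, map_smul, map_neg, inner_neg_left, inner_neg_right, inner_smul_left, inner_smul_right, map_mul, Complex.conj_ofReal]; ring
      rw [this, fyy, huu]; simp
    rw [h2, e2] at e1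
    have ht : t = 0 := by simpa using e1
    subst ht
    have : x = 0 := by simpa [z] using h0
    simp [this] at hx
  have hzc : Continuous z := by fun_prop
  let g : ℝ → ℝ := fun t => (f (z t) (z t)).re / ‖z t‖ ^ 2
  have hgc : Continuous g := by
    refine Continuous.div ?_ (by fun_prop) (fun t => by simpa using hz0 t)
    simp only [f]
    fun_prop
  have g0 : g 0 = 0 := by simp [g, z, fxx]
  have g1 : g 1 = 1 := by
    have h1 : f (z 1) (z 1) = 1 := by rw [fz]; simp
    have h2 : ‖z 1‖ = 1 := by simp [z, norm_smul, hu, hy]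
    simp [g, h1, h2]
  rw [segment_eq_image']
  rintro _ ⟨s, hs, rfl⟩
  have := intermediate_value_Icc (zero_le_one (α := ℝ)) hgc.continuousOn
  rw [g0, g1] at this
  obtain ⟨t, -, ht⟩ := this hs
  have hn : ‖z t‖ ≠ 0 := by simpa using hz0 t
  refine ⟨((‖z t‖⁻¹ : ℝ) : ℂ) • z t, ⟨E.smul_mem _ (E.add_mem (E.smul_mem _ hxE) (E.smul_mem _ hyE)), ?_⟩, ?_⟩
  · rw [norm_smul]; simp [hn]
  · have h1 : f (z t) (z t) = (s * ‖z t‖ ^ 2 : ℝ) := by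
      apply Complex.ext
      · rw [Complex.ofReal_re, ← ht]; simp only [g]; field_simp
      · rw [fim, Complex.ofReal_im]
    have h2 : inner ℂ (P (z t)) (R (z t)) = (s * ‖z t‖ ^ 2 : ℝ) * (q - p) + p * (‖z t‖ ^ 2 : ℝ) := by
      rw [← h1]
      have h3 : inner ℂ (z t) (z t) = ((‖z t‖ ^ 2 : ℝ) : ℂ) := by
        rw [inner_self_eq_norm_sq_to_K]; simp
      simp only [f, h3]
      field_simp
      ring
    simp only [map_smul, inner_smul_left, inner_smul_right, Complex.conj_ofReal, h2]
    have hn' : (‖z t‖ : ℂ) ≠ 0 := by exact_mod_cast hn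
    push_cast
    simp only [Complex.real_smul]
    field_simp
    ring

theorem norm_expand {K : Type*} [NormedAddCommGroup K] [InnerProductSpace ℂ K] (a b : K) (c : ℂ) :
    ‖a + c • b‖ ^ 2 = ‖a‖ ^ 2 + 2 * (c * inner ℂ a b).re + ‖c‖ ^ 2 * ‖b‖ ^ 2 := by
  have := norm_add_sq (𝕜 := ℂ) a (c • b)
  rw [this, inner_smul_right, norm_smul, mul_pow]
  rfl

theorem coercive_aux {K : Type*} [NormedAddCommGroup K] [InnerProductSpace ℂ K] (a b : K)
    (hb : b ≠ 0) : Tendsto (fun γ : ℂ => ‖a + γ • b‖ ^ 2) (cocompact ℂ) atTop := by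
  have hb' : 0 < ‖b‖ := norm_pos_iff.2 hb
  refine (tendsto_pow_atTop two_ne_zero).comp ?_
  have h1 : Tendsto (fun γ : ℂ => ‖γ‖ * ‖b‖ - ‖a‖) (cocompact ℂ) atTop := by
    apply tendsto_atTop_add_const_right
    exact (tendsto_norm_cocompact_atTop (E := ℂ)).atTop_mul_const hb'
  refine tendsto_atTop_mono (fun γ => ?_) h1
  have h2 := norm_sub_norm_le (γ • b) (-a)
  rw [norm_smul, norm_neg, sub_neg_eq_add, add_comm (γ • b)] at h2
  exact h2

set_option maxHeartbeats 1000000 in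
/-- Finite-dimensional core. -/
theorem fd_core {W K : Type*} [NormedAddCommGroup W] [InnerProductSpace ℂ W]
    [FiniteDimensional ℂ W]
    [NormedAddCommGroup K] [InnerProductSpace ℂ K] (P R N : W →L[ℂ] K) (M : ℝ)
    (hyp : ∀ x, ∃ γ : ℂ, ‖P x + γ • R x‖ ^ 2 ≤ M * ‖N x‖ ^ 2) :
    ∃ γ : ℂ, ∀ x, ‖P x + γ • R x‖ ^ 2 ≤ M * ‖N x‖ ^ 2 := by
  by_cases hR : ∀ x, R x = 0
  · refine ⟨0, fun x => ?_⟩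
    obtain ⟨γ, h⟩ := hyp x
    simpa [hR x] using h
  push Not at hR
  obtain ⟨u, hu⟩ := hR
  have hu0 : u ≠ 0 := by rintro rfl; simp at hu
  have : ProperSpace W := FiniteDimensional.proper ℂ W
  have hK : IsCompact (Metric.sphere (0 : W) 1) := isCompact_sphere 0 1
  let Q : ℂ → W → ℝ := fun γ x => ‖P x + γ • R x‖ ^ 2 - M * ‖N x‖ ^ 2
  have hQc : Continuous ↿Q := by
    change Continuous (fun p : ℂ × W => ‖P p.2 + p.1 • R p.2‖ ^ 2 - M * ‖N p.2‖ ^ 2)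
    fun_prop
  have hQc' : Continuous (fun p : ℂ × W => Q p.1 p.2) := hQc
  have hQγ : ∀ γ, Continuous (Q γ) := fun γ => by simp only [Q]; fun_prop
  have hQs : ∀ γ (c : ℂ) x, Q γ (c • x) = ‖c‖ ^ 2 * Q γ x := by
    intro γ c x
    simp only [Q, map_smul]
    rw [smul_comm γ c, ← smul_add, norm_smul, norm_smul]; ring
  let F : ℂ → ℝ := fun γ => sSup (Q γ '' Metric.sphere (0 : W) 1)
  have hFc : Continuous F := hK.continuous_sSup hQc
  have hbdd : ∀ γ, BddAbove (Q γ '' Metric.sphere (0 : W) 1) := fun γ =>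
    (hK.image (hQγ γ)).bddAbove
  have hQF1 : ∀ γ x, ‖x‖ = 1 → Q γ x ≤ F γ := fun γ x hx =>
    le_csSup (hbdd γ) ⟨x, by simpa using hx, rfl⟩
  have hQF : ∀ γ x, Q γ x ≤ ‖x‖ ^ 2 * F γ := by
    intro γ x
    by_cases hx : x = 0
    · simp [hx, Q]
    have hn : ‖x‖ ≠ 0 := by simpa using hx
    have h1 := hQF1 γ (((‖x‖⁻¹ : ℝ) : ℂ) • x) (by rw [norm_smul]; simp [hn])
    have h2 : x = (‖x‖ : ℂ) • (((‖x‖⁻¹ : ℝ) : ℂ) • x) := by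
      rw [smul_smul, ← Complex.ofReal_mul, mul_inv_cancel₀ hn]; simp
    calc Q γ x = ‖x‖ ^ 2 * Q γ (((‖x‖⁻¹ : ℝ) : ℂ) • x) := by
          conv_lhs => rw [h2]
          rw [hQs γ (‖x‖ : ℂ)]; simp
      _ ≤ _ := by gcongr
  have hne : (Metric.sphere (0 : W) 1).Nonempty := by
    have hn : ‖u‖ ≠ 0 := by simpa using hu0
    refine ⟨((‖u‖⁻¹ : ℝ) : ℂ) • u, ?_⟩
    rw [mem_sphere_zero_iff_norm, norm_smul]; simp [hn]
  have hatt : ∀ γ, ∃ x, ‖x‖ = 1 ∧ Q γ x = F γ := by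
    intro γ
    obtain ⟨x, hx, h⟩ := hK.exists_sSup_image_eq hne (hQγ γ).continuousOn
    exact ⟨x, by simpa using hx, h.symm⟩
  have hFt : Tendsto F (cocompact ℂ) atTop := by
    have hn : 0 < ‖u‖ ^ 2 := by positivity
    have h1 : Tendsto (fun γ => Q γ u) (cocompact ℂ) atTop :=
      tendsto_atTop_add_const_right _ _ (coercive_aux (P u) (R u) hu)
    refine tendsto_atTop_mono (fun γ => ?_) (h1.atTop_div_const hn)
    rw [div_le_iff₀ hn, mul_comm]; exact hQF γ u
  obtain ⟨γ0, hγ0⟩ := hFc.exists_forall_le hFt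
  by_cases hm : F γ0 ≤ 0
  · refine ⟨γ0, fun x => ?_⟩
    have h1 := hQF γ0 x
    have h2 : ‖x‖ ^ 2 * F γ0 ≤ 0 := mul_nonpos_of_nonneg_of_nonpos (by positivity) hm
    simp only [Q] at h1
    linarith
  exfalso
  push Not at hm
  set m := F γ0 with hmdef
  let P0 : W →L[ℂ] K := P + γ0 • R
  have hP0 : ∀ γ x, P x + γ • R x = P0 x + (γ - γ0) • R x := by
    intro γ x; simp [P0, sub_smul]
  have hQ0 : ∀ x, Q γ0 x = ‖P0 x‖ ^ 2 - M * ‖N x‖ ^ 2 := by intro x; simp [Q, P0]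
  have hQexp : ∀ c x, Q (γ0 + c) x =
      Q γ0 x + 2 * (c * inner ℂ (P0 x) (R x)).re + ‖c‖ ^ 2 * ‖R x‖ ^ 2 := by
    intro c x
    rw [hQ0]; simp only [Q]
    rw [hP0, add_sub_cancel_left, norm_expand]; ring
  let E : Submodule ℂ W :=
    { carrier := {x | Q γ0 x = m * ‖x‖ ^ 2}
      zero_mem' := by simp [Q]
      smul_mem' := by
        intro c x hx
        simp only [Set.mem_ofPred_eq] at hx ⊢
        rw [hQs, hx, norm_smul]; ring
      add_mem' := by
        intro x y hx hy
        simp only [Set.mem_ofPred_eq] at hx hy ⊢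
        have h1 := hQF γ0 (x + y)
        have h2 := hQF γ0 (x - y)
        have e1 := parallelogram_law_with_norm ℂ x y
        have e2 := parallelogram_law_with_norm ℂ (P0 x) (P0 y)
        have e3 := parallelogram_law_with_norm ℂ (N x) (N y)
        rw [hQ0, map_add, map_add, ← hmdef] at h1
        rw [hQ0, map_sub, map_sub, ← hmdef] at h2
        rw [hQ0] at hx hy
        rw [hQ0, map_add, map_add]
        have e1' := congrArg (fun r => m * r) e1
        have e3' := congrArg (fun r => M * r) e3
        simp only [mul_add] at e1' e3'
        apply le_antisymm <;> linarith }
  have hEmem : ∀ x, x ∈ E ↔ Q γ0 x = m * ‖x‖ ^ 2 := fun x => Iff.rfl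
  let B := (fun x => inner ℂ (P0 x) (R x)) '' {x : W | x ∈ E ∧ ‖x‖ = 1}
  have hBconv : Convex ℝ B := toeplitz_hausdorff P0 R E
  have hBcomp : IsCompact B := by
    refine IsCompact.image ?_ (by fun_prop)
    have : {x : W | x ∈ E ∧ ‖x‖ = 1} = Metric.sphere (0 : W) 1 ∩ {x | Q γ0 x = m * ‖x‖ ^ 2} := by
      ext x; simp [hEmem, and_comm]
    rw [this]
    exact hK.inter_right (isClosed_eq (hQγ γ0) (by fun_prop))
  have h0B : (0 : ℂ) ∉ B := by
    rintro ⟨x, ⟨hxE, hx⟩, h0⟩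
    obtain ⟨γ, hγ⟩ := hyp x
    have h1 := hQexp (γ - γ0) x
    simp only [] at h0
    rw [h0, add_sub_cancel, (hEmem x).1 hxE, hx] at h1
    simp only [Q, mul_zero, Complex.zero_re] at h1
    have : 0 ≤ ‖γ - γ0‖ ^ 2 * ‖R x‖ ^ 2 := by positivity
    linarith
  obtain ⟨φ, s, hs0, hs⟩ := geometric_hahn_banach_point_closed hBconv hBcomp.isClosed h0B
  rw [map_zero] at hs0
  -- represent φ
  let c : ℂ := -((φ 1 : ℝ) : ℂ) + (φ Complex.I : ℝ) * Complex.I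
  have hc : ∀ w : ℂ, (c * w).re = - φ w := by
    intro w
    have : w = w.re • (1 : ℂ) + w.im • Complex.I := by
      simp [Complex.real_smul, Complex.re_add_im]
    conv_rhs => rw [this, map_add, map_smul, map_smul]
    simp [c]; ring
  have hneg : ∀ x ∈ E, ‖x‖ = 1 → (c * inner ℂ (P0 x) (R x)).re < 0 := by
    intro x hx hx1
    rw [hc]
    have := hs _ ⟨x, ⟨hx, hx1⟩, rfl⟩
    simp only [] at this
    linarith
  let t : ℕ → ℝ := fun n => 1 / ((n : ℝ) + 1)
  have ht : Tendsto t atTop (𝓝 0) := tendsto_one_div_add_atTop_nhds_zero_nat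
  have htpos : ∀ n, 0 < t n := fun n => by simp only [t]; positivity
  clear_value t c
  choose xs hxs1 hxs2 using fun n => hatt (γ0 + (t n : ℂ) * c)
  obtain ⟨x, hx, φs, hφs, hlim⟩ := hK.tendsto_subseq (x := xs) (fun n => by simpa using hxs1 n)
  have hx1 : ‖x‖ = 1 := by simpa using hx
  have htφ : Tendsto (fun n => t (φs n)) atTop (𝓝 0) := ht.comp hφs.tendsto_atTop
  have hge : ∀ n, m ≤ Q (γ0 + (t n : ℂ) * c) (xs n) := fun n => by rw [hxs2]; exact hγ0 _
  have hxE : x ∈ E := by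
    rw [hEmem, hx1]
    apply le_antisymm
    · have := hQF1 γ0 x hx1; linarith
    · have hl : Tendsto (fun n => Q (γ0 + (t (φs n) : ℂ) * c) (xs (φs n))) atTop (𝓝 (Q γ0 x)) := by
        have h1 : Tendsto (fun n => (γ0 + (t (φs n) : ℂ) * c, xs (φs n))) atTop (𝓝 (γ0, x)) := by
          refine Tendsto.prodMk_nhds ?_ hlim
          have h2 : Tendsto (fun n => ((t (φs n) : ℝ) : ℂ)) atTop (𝓝 ((0 : ℝ) : ℂ)) :=
            (Complex.continuous_ofReal.tendsto 0).comp htφ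
          have := (h2.mul_const c).const_add γ0
          simpa using this
        have h5 : Tendsto (fun p : ℂ × W => Q p.1 p.2) (𝓝 (γ0, x)) (𝓝 (Q γ0 x)) :=
          hQc'.tendsto (γ0, x)
        have h6 := h5.comp h1
        simp only [Function.comp_def] at h6
        exact h6
      have := ge_of_tendsto' hl (fun n => hge (φs n))
      linarith
  have hge2 : ∀ n, 0 ≤ 2 * (c * inner ℂ (P0 (xs n)) (R (xs n))).re
      + t n * (‖c‖ ^ 2 * ‖R (xs n)‖ ^ 2) := by
    intro n
    have h1 := hge n
    rw [hQexp, mul_assoc, Complex.re_ofReal_mul, norm_mul, Complex.norm_real, Real.norm_eq_abs,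
      abs_of_pos (htpos n)] at h1
    have h2 := hQF1 γ0 (xs n) (hxs1 n)
    have h3 : 0 ≤ t n * (2 * (c * inner ℂ (P0 (xs n)) (R (xs n))).re
      + t n * (‖c‖ ^ 2 * ‖R (xs n)‖ ^ 2)) := by nlinarith
    exact nonneg_of_mul_nonneg_right h3 (htpos n)
  have hfin : 0 ≤ 2 * (c * inner ℂ (P0 x) (R x)).re + 0 * (‖c‖ ^ 2 * ‖R x‖ ^ 2) := by
    have hcont1 : Continuous (fun y : W => 2 * (c * inner ℂ (P0 y) (R y)).re) := by fun_prop
    have hcont2 : Continuous (fun y : W => ‖c‖ ^ 2 * ‖R y‖ ^ 2) := by fun_prop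
    have hl := ((hcont1.tendsto x).comp hlim).add (htφ.mul ((hcont2.tendsto x).comp hlim))
    exact ge_of_tendsto' hl (fun n => hge2 (φs n))
  have := hneg x hxE hx1
  linarith

theorem global_core {K : Type*} [NormedAddCommGroup K] [InnerProductSpace ℂ K]
    (P R N : K →L[ℂ] K) (M : ℝ)
    (hyp : ∀ x, ∃ γ : ℂ, ‖P x + γ • R x‖ ^ 2 ≤ M * ‖N x‖ ^ 2) :
    ∃ γ : ℂ, ∀ x, ‖P x + γ • R x‖ ^ 2 ≤ M * ‖N x‖ ^ 2 := by
  classical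
  by_cases hR : ∀ x, R x = 0
  · refine ⟨0, fun x => ?_⟩
    obtain ⟨γ, h⟩ := hyp x
    simpa [hR x] using h
  push Not at hR
  obtain ⟨u, hu⟩ := hR
  let C : K → Set ℂ := fun x => {γ | ‖P x + γ • R x‖ ^ 2 ≤ M * ‖N x‖ ^ 2}
  have hCc : ∀ x, IsClosed (C x) := fun x => isClosed_le (by fun_prop) (by fun_prop)
  have hCu : IsCompact (C u) := by
    have h1 := (coercive_aux (P u) (R u) hu).eventually_gt_atTop (M * ‖N u‖ ^ 2)
    obtain ⟨t, ht, hsub⟩ := mem_cocompact.1 h1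
    refine ht.of_isClosed_subset (hCc u) (fun γ hγ => ?_)
    by_contra hcon
    have := hsub hcon
    simp only [Set.mem_ofPred_eq, C] at this hγ
    linarith
  obtain ⟨γ, -, hγ⟩ := hCu.inter_iInter_nonempty C hCc (by
    intro s
    let V : Submodule ℂ K := Submodule.span ℂ ((insert u s : Finset K) : Set K)
    have : FiniteDimensional ℂ V := FiniteDimensional.span_finset ℂ _
    obtain ⟨γ, hγ⟩ := fd_core (P.comp V.subtypeL) (R.comp V.subtypeL) (N.comp V.subtypeL) M
      (fun x => hyp x)
    have hmem : ∀ x ∈ insert u s, γ ∈ C x := fun x hx =>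
      hγ ⟨x, Submodule.subset_span hx⟩
    refine ⟨γ, hmem u (Finset.mem_insert_self _ _), ?_⟩
    simp only [Set.mem_iInter]
    exact fun x hx => hmem x (Finset.mem_insert_of_mem hx))
  rw [Set.mem_iInter] at hγ
  exact ⟨γ, hγ⟩

theorem att_aux {K : Type*} [NormedAddCommGroup K] [InnerProductSpace ℂ K] (a b : K) :
    ∃ γ : ℂ, ‖a + γ • b‖ ^ 2 ≤ ⨅ γ : ℂ, ‖a + γ • b‖ ^ 2 := by
  by_cases hb : b = 0
  · exact ⟨0, by simp [hb]⟩
  · have hc : Continuous (fun γ : ℂ => ‖a + γ • b‖ ^ 2) := by fun_prop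
    obtain ⟨γ, h⟩ := hc.exists_forall_le (coercive_aux a b hb)
    exact ⟨γ, le_ciInf h⟩

theorem stmt17 [CompleteSpace H] (A T S : H →L[ℂ] H) (hA : A.IsPositive)
    (hT : ABounded A T) (hS : ABounded A S) :
    (⨅ γ : ℂ, sSup {r : ℝ | ∃ x : H, normA A x = 1 ∧ r = normA A (T x + γ • S x) ^ 2}) =
    sSup {r : ℝ | ∃ x : H, normA A x = 1 ∧ r = ⨅ γ : ℂ, normA A (T x + γ • S x) ^ 2} := by
  have hA0 : (0 : H →L[ℂ] H) ≤ A := (ContinuousLinearMap.nonneg_iff_isPositive A).2 hA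
  set B : H →L[ℂ] H := CFC.sqrt A with hB
  have hBB : B * B = A := CFC.sqrt_mul_sqrt_self A hA0
  have hBs : B.IsPositive := (ContinuousLinearMap.nonneg_iff_isPositive B).1 (CFC.sqrt_nonneg A)
  have hn : ∀ x, normA A x = ‖B x‖ := by
    intro x
    have h1 : innerA A x x = inner ℂ (B x) (B x) := by
      unfold innerA
      rw [← hBB]
      exact hBs.isSymmetric (B x) x
    unfold normA
    rw [h1, inner_self_eq_norm_sq_to_K]
    simp [← Complex.ofReal_pow]
  obtain ⟨a, ha, hT⟩ := hT
  obtain ⟨b, hb, hS⟩ := hS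
  simp only [hn, map_add, map_smul] at hT hS ⊢
  have hbddb : ∀ x, BddBelow (Set.range fun γ : ℂ => ‖B (T x) + γ • B (S x)‖ ^ 2) := fun x =>
    ⟨0, by rintro _ ⟨γ, rfl⟩; positivity⟩
  have hle : ∀ x (γ : ℂ), ‖B x‖ = 1 → ‖B (T x) + γ • B (S x)‖ ^ 2 ≤ (a + ‖γ‖ * b) ^ 2 := by
    intro x γ hx
    have h1 := hT x
    have h2 := hS x
    rw [hx, mul_one] at h1 h2
    have h3 : ‖B (T x) + γ • B (S x)‖ ≤ a + ‖γ‖ * b := by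
      refine (norm_add_le _ _).trans ?_
      rw [norm_smul]
      gcongr
    gcongr
  set M := sSup {r : ℝ | ∃ x : H, ‖B x‖ = 1 ∧ r = ⨅ γ : ℂ, ‖B (T x) + γ • B (S x)‖ ^ 2} with hM
  have hM0 : 0 ≤ M := by
    apply Real.sSup_nonneg
    rintro _ ⟨x, -, rfl⟩
    exact Real.iInf_nonneg (fun γ => by positivity)
  apply le_antisymm
  · have hMb : ∀ x, ‖B x‖ = 1 → (⨅ γ : ℂ, ‖B (T x) + γ • B (S x)‖ ^ 2) ≤ M := by
      intro x hx
      refine le_csSup ⟨(a + ‖(0 : ℂ)‖ * b) ^ 2, ?_⟩ ⟨x, hx, rfl⟩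
      rintro _ ⟨y, hy, rfl⟩
      exact (ciInf_le (hbddb y) 0).trans (hle y 0 hy)
    obtain ⟨γ, hγ⟩ := global_core (B * T) (B * S) B M (by
      intro x
      change ∃ γ : ℂ, ‖B (T x) + γ • B (S x)‖ ^ 2 ≤ M * ‖B x‖ ^ 2
      by_cases hx : ‖B x‖ = 0
      · have h1 := hT x
        have h2 := hS x
        rw [hx, mul_zero] at h1 h2
        have h1' : B (T x) = 0 := norm_le_zero_iff.1 h1
        have h2' : B (S x) = 0 := norm_le_zero_iff.1 h2
        exact ⟨0, by simp [h1', h2', hx]⟩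
      · set y : H := ((‖B x‖⁻¹ : ℝ) : ℂ) • x with hy
        have hy1 : ‖B y‖ = 1 := by rw [hy, map_smul, norm_smul]; simp [hx]
        obtain ⟨γ, hγ⟩ := att_aux (B (T y)) (B (S y))
        refine ⟨γ, ?_⟩
        have h3 : x = ((‖B x‖ : ℝ) : ℂ) • y := by
          rw [hy, smul_smul, ← Complex.ofReal_mul, mul_inv_cancel₀ hx]; simp
        have h4 : B (T x) + γ • B (S x) = ((‖B x‖ : ℝ) : ℂ) • (B (T y) + γ • B (S y)) := by
          conv_lhs => rw [h3]
          simp only [map_smul]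
          rw [smul_comm γ, smul_add]
        rw [h4, norm_smul, mul_pow, Complex.norm_real, norm_norm, mul_comm M]
        have := hγ.trans (hMb y hy1)
        gcongr)
    refine (ciInf_le ⟨0, ?_⟩ γ).trans ?_
    · rintro _ ⟨γ, rfl⟩
      apply Real.sSup_nonneg
      rintro _ ⟨x, -, rfl⟩
      positivity
    · refine Real.sSup_le ?_ hM0
      rintro _ ⟨x, hx, rfl⟩
      have := hγ x
      rw [hx, one_pow, mul_one] at this
      exact this
  · refine le_ciInf (fun γ => Real.sSup_le ?_ ?_)
    · rintro _ ⟨x, hx, rfl⟩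
      refine (ciInf_le (hbddb x) γ).trans (le_csSup ⟨(a + ‖γ‖ * b) ^ 2, ?_⟩ ⟨x, hx, rfl⟩)
      rintro _ ⟨y, hy, rfl⟩
      exact hle y γ hy
    · apply Real.sSup_nonneg
      rintro _ ⟨x, -, rfl⟩
      positivity
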